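/- arXiv:1807.08594 — 2 statements merged into one kernel-verified Lean document; each statement's English description precedes it below -/
import Mathlib

section
/- Let Y_{ab} be a smooth Yano tensor of rank two on U. Then for all indices a,b,c,d the following purely algebraic relation between Y and the curvature holds: Y_{ma}(R^m_{dbc} + R^m_{cbd}) + Y_{mb}(R^m_{dac} + R^m_{cad}) + Y_{mc}(R^m_{adb} + R^m_{bda}) + Y_{md}(R^m_{acb} + R^m_{bca}) = 0 (sum over m). -/
/-!
STATEMENT 4: For a Yano tensor `Y` of rank two, the algebraic relation
`Y_{ma}(R^m_{dbc}+R^m_{cbd}) + Y_{mb}(R^m_{dac}+R^m_{cad})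
 + Y_{mc}(R^m_{adb}+R^m_{bda}) + Y_{md}(R^m_{acb}+R^m_{bca}) = 0` holds.
-/

noncomputable section

abbrev Pt : Type := Fin 4 → ℝ

/-- Partial derivative of a scalar field in the `c`-th coordinate direction. -/
def pd (f : Pt → ℝ) (c : Fin 4) (p : Pt) : ℝ := fderiv ℝ f p (Pi.single c 1)

/-- Covariant derivative `∇_c Y_{ab}` of a (0,2)-tensor field. -/
def cov2 (Γ : Fin 4 → Fin 4 → Fin 4 → Pt → ℝ) (Y : Fin 4 → Fin 4 → Pt → ℝ)
    (c a b : Fin 4) (p : Pt) : ℝ :=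
  pd (Y a b) c p - ∑ m, Γ m c a p * Y m b p - ∑ m, Γ m c b p * Y a m p

/-- The curvature tensor `R^m_{acd}` of the connection `Γ`. -/
def Riem (Γ : Fin 4 → Fin 4 → Fin 4 → Pt → ℝ) (m a c d : Fin 4) (p : Pt) : ℝ :=
  pd (Γ m d a) c p - pd (Γ m c a) d p
    + ∑ n, Γ m c n p * Γ n d a p - ∑ n, Γ m d n p * Γ n c a p

/-- Covariant derivative `∇_d T_{cab}` of a (0,3)-tensor field. -/
def cov3 (Γ : Fin 4 → Fin 4 → Fin 4 → Pt → ℝ) (T : Fin 4 → Fin 4 → Fin 4 → Pt → ℝ)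
    (d c a b : Fin 4) (p : Pt) : ℝ :=
  pd (T c a b) d p - ∑ m, Γ m d c p * T m a b p - ∑ m, Γ m d a p * T c m b p
    - ∑ m, Γ m d b p * T c a m p

section PartialDerivative

variable {f g : Pt → ℝ} {p : Pt}

lemma pd_sub (hf : DifferentiableAt ℝ f p) (hg : DifferentiableAt ℝ g p) (c : Fin 4) :
    pd (fun q => f q - g q) c p = pd f c p - pd g c p := by
  simp [pd, fderiv_fun_sub hf hg]

lemma pd_mul (hf : DifferentiableAt ℝ f p) (hg : DifferentiableAt ℝ g p) (c : Fin 4) :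
    pd (fun q => f q * g q) c p = pd f c p * g p + f p * pd g c p := by
  simp [pd, fderiv_fun_mul hf hg]
  ring

lemma pd_sum {F : Fin 4 → Pt → ℝ} (hF : ∀ m, DifferentiableAt ℝ (F m) p) (c : Fin 4) :
    pd (fun q => ∑ m, F m q) c p = ∑ m, pd (F m) c p := by
  simp [pd, fderiv_fun_sum fun m _ => hF m]

lemma pd_neg (c : Fin 4) : pd (fun q => -f q) c p = -pd f c p := by
  simp [pd, fderiv_fun_neg]

lemma pd_congr_of_eqOn {U : Set Pt} (hU : IsOpen U) (hp : p ∈ U) (h : ∀ q ∈ U, f q = g q)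
    (c : Fin 4) : pd f c p = pd g c p := by
  have : f =ᶠ[nhds p] g := Filter.eventually_of_mem (hU.mem_nhds hp) h
  rw [pd, pd, this.fderiv_eq]

lemma differentiableAt_fderiv (hf : ContDiffAt ℝ (⊤ : ℕ∞) f p) :
    DifferentiableAt ℝ (fderiv ℝ f) p :=
  (hf.fderiv_right (m := 1) (WithTop.coe_le_coe.mpr (le_top : (1 + 1 : ℕ∞) ≤ ⊤))).differentiableAt (by simp)

lemma differentiableAt_pd (hf : ContDiffAt ℝ (⊤ : ℕ∞) f p) (c : Fin 4) :
    DifferentiableAt ℝ (pd f c) p :=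
  (differentiableAt_fderiv hf).clm_apply (differentiableAt_const _)

lemma pd_comm (hf : ContDiffAt ℝ (⊤ : ℕ∞) f p) (c d : Fin 4) :
    pd (pd f c) d p = pd (pd f d) c p := by
  have key (c d : Fin 4) :
      pd (pd f c) d p = fderiv ℝ (fderiv ℝ f) p (Pi.single d 1) (Pi.single c 1) := by
    change fderiv ℝ (fun q => fderiv ℝ f q (Pi.single c 1)) p (Pi.single d 1) = _
    rw [fderiv_clm_apply (differentiableAt_fderiv hf) (differentiableAt_const _)]
    simp
  rw [key, key]
  refine (hf.isSymmSndFDerivAt ?_).eq _ _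
  simp only [minSmoothness_of_isRCLikeNormedField]
  exact WithTop.coe_le_coe.mpr (le_top : (2 : ℕ∞) ≤ ⊤)

end PartialDerivative

section Curvature

variable {Γ : Fin 4 → Fin 4 → Fin 4 → Pt → ℝ} {Y : Fin 4 → Fin 4 → Pt → ℝ} {p : Pt}

lemma riem_antisymm (m a c d : Fin 4) : Riem Γ m a c d p = -Riem Γ m a d c p := by
  simp only [Riem]
  ring

lemma pd_cov2 (hΓ : ∀ m a b, ContDiffAt ℝ (⊤ : ℕ∞) (Γ m a b) p)
    (hY : ∀ a b, ContDiffAt ℝ (⊤ : ℕ∞) (Y a b) p) (d c a b : Fin 4) :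
    pd (cov2 Γ Y c a b) d p = pd (pd (Y a b) c) d p
      - ∑ m, (pd (Γ m c a) d p * Y m b p + Γ m c a p * pd (Y m b) d p)
      - ∑ m, (pd (Γ m c b) d p * Y a m p + Γ m c b p * pd (Y a m) d p) := by
  have hΓ' m a b : DifferentiableAt ℝ (Γ m a b) p := (hΓ m a b).differentiableAt (by simp)
  have hY' a b : DifferentiableAt ℝ (Y a b) p := (hY a b).differentiableAt (by simp)
  have h₁ m : DifferentiableAt ℝ (fun q => Γ m c a q * Y m b q) p := (hΓ' _ _ _).mul (hY' _ _)
  have h₂ m : DifferentiableAt ℝ (fun q => Γ m c b q * Y a m q) p := (hΓ' _ _ _).mul (hY' _ _)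
  have s₁ := DifferentiableAt.fun_sum (u := Finset.univ) fun m _ => h₁ m
  have s₂ := DifferentiableAt.fun_sum (u := Finset.univ) fun m _ => h₂ m
  have hpd := differentiableAt_pd (hY a b) c
  change pd (fun q => pd (Y a b) c q - ∑ m, Γ m c a q * Y m b q - ∑ m, Γ m c b q * Y a m q) d p = _
  rw [pd_sub (hpd.fun_sub s₁) s₂, pd_sub hpd s₁, pd_sum h₁, pd_sum h₂]
  simp only [pd_mul (hΓ' _ _ _) (hY' _ _)]

/-- The Ricci identity for a (0,2)-tensor field and a torsion-free connection. -/
lemma ricci_identity (hΓ : ∀ m a b, ContDiffAt ℝ (⊤ : ℕ∞) (Γ m a b) p)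
    (hsymm : ∀ m a b, Γ m a b p = Γ m b a p)
    (hY : ∀ a b, ContDiffAt ℝ (⊤ : ℕ∞) (Y a b) p) (d c a b : Fin 4) :
    cov3 Γ (cov2 Γ Y) d c a b p - cov3 Γ (cov2 Γ Y) c d a b p =
      -∑ m, (Riem Γ m a d c p * Y m b p + Riem Γ m b d c p * Y a m p) := by
  have htorsion : ∑ m, Γ m d c p * cov2 Γ Y m a b p = ∑ m, Γ m c d p * cov2 Γ Y m a b p := by
    simp only [hsymm _ d c]
  simp only [cov3]
  rw [htorsion, pd_cov2 hΓ hY, pd_cov2 hΓ hY, pd_comm (hY a b) c d]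
  simp only [cov2, Riem, Fin.sum_univ_four]
  ring

end Curvature

theorem yano_curvature_algebraic_relation
    (U : Set Pt) (hU : IsOpen U)
    (Γ : Fin 4 → Fin 4 → Fin 4 → Pt → ℝ)
    (hΓsmooth : ∀ m a b, ContDiffOn ℝ (⊤ : ℕ∞) (Γ m a b) U)
    (hΓsymm : ∀ m a b, ∀ p ∈ U, Γ m a b p = Γ m b a p)
    (Y : Fin 4 → Fin 4 → Pt → ℝ)
    (hYsmooth : ∀ a b, ContDiffOn ℝ (⊤ : ℕ∞) (Y a b) U)
    (hYanti : ∀ a b, ∀ p ∈ U, Y a b p = - Y b a p)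
    (hYano : ∀ a b c, ∀ p ∈ U, cov2 Γ Y c b a p + cov2 Γ Y b c a p = 0) :
    ∀ p ∈ U, ∀ a b c d,
      (∑ m, Y m a p * (Riem Γ m d b c p + Riem Γ m c b d p))
        + (∑ m, Y m b p * (Riem Γ m d a c p + Riem Γ m c a d p))
        + (∑ m, Y m c p * (Riem Γ m a d b p + Riem Γ m b d a p))
        + (∑ m, Y m d p * (Riem Γ m a c b p + Riem Γ m b c a p)) = 0 := by
  intro p hp a b c d
  have hΓ m a b : ContDiffAt ℝ (⊤ : ℕ∞) (Γ m a b) p := (hΓsmooth m a b).contDiffAt (hU.mem_nhds hp)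
  have hY a b : ContDiffAt ℝ (⊤ : ℕ∞) (Y a b) p := (hYsmooth a b).contDiffAt (hU.mem_nhds hp)
  have hTfst : ∀ c a b, ∀ q ∈ U, cov2 Γ Y c a b q = -cov2 Γ Y a c b q := fun c a b q hq =>
    eq_neg_of_add_eq_zero_left (hYano b a c q hq)
  have hTsnd : ∀ c a b, ∀ q ∈ U, cov2 Γ Y c a b q = -cov2 Γ Y c b a q := by
    intro c a b q hq
    have hpd : pd (Y a b) c q = -pd (Y b a) c q := by
      rw [pd_congr_of_eqOn hU hq (hYanti a b), pd_neg]
    simp only [cov2, hpd, hYanti a _ q hq, hYanti _ b q hq, mul_neg, Finset.sum_neg_distrib]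
    ring
  have hSsnd (d c a b : Fin 4) :
      cov3 Γ (cov2 Γ Y) d c a b p = -cov3 Γ (cov2 Γ Y) d a c b p := by
    simp only [cov3]
    rw [pd_congr_of_eqOn hU hp (hTfst c a b), pd_neg]
    simp only [hTfst c _ _ p hp, hTfst _ a _ p hp, mul_neg, Finset.sum_neg_distrib]
    ring
  have hSthd (d c a b : Fin 4) :
      cov3 Γ (cov2 Γ Y) d c a b p = -cov3 Γ (cov2 Γ Y) d c b a p := by
    simp only [cov3]
    rw [pd_congr_of_eqOn hU hp (hTsnd c a b), pd_neg]
    simp only [hTsnd _ a _ p hp, hTsnd _ _ b p hp, mul_neg, Finset.sum_neg_distrib]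
    ring
  have ricci := ricci_identity hΓ (fun m a b => hΓsymm m a b p hp) hY
  have key := congrArg₂ (· + ·)
    (congrArg₂ (· + ·) (ricci b c d a) (ricci b d c a))
    (congrArg₂ (· + ·) (ricci a c d b) (ricci a d c b))
  simp only [hYanti c _ p hp, hYanti d _ p hp, riem_antisymm _ a b, riem_antisymm _ b a,
    Fin.sum_univ_four] at key
  simp only [Fin.sum_univ_four]
  linear_combination key - hSsnd b c d a - hSsnd a c d b
    + hSsnd c b d a - hSthd c d b a + hSsnd c d a b
    + hSsnd d b c a - hSthd d c b a + hSsnd d c a b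
end
end

section
/- Let Y_{ab} be a Yano tensor of rank two on U. Then its square K_{ab} := Y_{am}g^{mn}Y_{nb} is a Killing tensor of rank two, i.e. K is symmetric and its symmetrized covariant derivative vanishes: ∇_aK_{bc} + ∇_bK_{ca} + ∇_cK_{ab} = 0 on U. -/
/-!
STATEMENT 9: The square `K_{ab} := Y_{am}g^{mn}Y_{nb}` of a Yano tensor of rank
two is a Killing tensor of rank two: `K` is symmetric and
`∇_aK_{bc} + ∇_bK_{ca} + ∇_cK_{ab} = 0`.
-/

noncomputable section

/-- The square `K_{ab} = Y_{am} g^{mn} Y_{nb}` of a (0,2)-tensor `Y`. -/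
def Ksq (ginv Y : Fin 4 → Fin 4 → Pt → ℝ) (a b : Fin 4) (p : Pt) : ℝ :=
  ∑ m, ∑ n, Y a m p * ginv m n p * Y n b p

/-- The matrix of partial derivatives `∂_c M_{ab}` of a matrix of scalar fields. -/
def pdMatrix (M : Fin 4 → Fin 4 → Pt → ℝ) (c : Fin 4) (p : Pt) : Matrix (Fin 4) (Fin 4) ℝ :=
  Matrix.of fun a b => pd (M a b) c p

/-- The matrix of values of a matrix of scalar fields. -/
def valMatrix (M : Fin 4 → Fin 4 → Pt → ℝ) (p : Pt) : Matrix (Fin 4) (Fin 4) ℝ :=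
  Matrix.of fun a b => M a b p

/-- The connection matrix `(m, a) ↦ Γ^m_{ca}` in direction `c`. -/
def connMatrix (Γ : Fin 4 → Fin 4 → Fin 4 → Pt → ℝ) (c : Fin 4) (p : Pt) :
    Matrix (Fin 4) (Fin 4) ℝ :=
  Matrix.of fun m a => Γ m c a p

/-- The matrix `(a, b) ↦ ∇_c Y_{ab}`. -/
def covMatrix (Γ : Fin 4 → Fin 4 → Fin 4 → Pt → ℝ) (Y : Fin 4 → Fin 4 → Pt → ℝ)
    (c : Fin 4) (p : Pt) : Matrix (Fin 4) (Fin 4) ℝ :=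
  Matrix.of fun a b => cov2 Γ Y c a b p

open Matrix in
lemma covMatrix_eq (Γ : Fin 4 → Fin 4 → Fin 4 → Pt → ℝ) (Y : Fin 4 → Fin 4 → Pt → ℝ)
    (c : Fin 4) (p : Pt) :
    covMatrix Γ Y c p = pdMatrix Y c p - (connMatrix Γ c p)ᵀ * valMatrix Y p
      - valMatrix Y p * connMatrix Γ c p := by
  ext a b
  simp [covMatrix, pdMatrix, valMatrix, connMatrix, cov2, Matrix.mul_apply, mul_comm]

lemma pdMatrix_mul {M N : Fin 4 → Fin 4 → Pt → ℝ} {p : Pt}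
    (hM : ∀ a b, DifferentiableAt ℝ (M a b) p) (hN : ∀ a b, DifferentiableAt ℝ (N a b) p)
    (c : Fin 4) :
    pdMatrix (fun a b q => ∑ m, M a m q * N m b q) c p
      = pdMatrix M c p * valMatrix N p + valMatrix M p * pdMatrix N c p := by
  ext a b
  simp only [pdMatrix, valMatrix, pd, Matrix.add_apply, Matrix.mul_apply, Matrix.of_apply]
  rw [fderiv_fun_sum fun m _ => (hM a m).fun_mul (hN m b), sum_apply,
    ← Finset.sum_add_distrib]
  refine Finset.sum_congr rfl fun m _ => ?_
  rw [fderiv_fun_mul (hM a m) (hN m b)]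
  simp only [add_apply, smul_apply, smul_eq_mul]
  ring

lemma pd_congr {f h : Pt → ℝ} {p : Pt} (hfh : f =ᶠ[nhds p] h) (c : Fin 4) :
    pd f c p = pd h c p := by
  rw [pd, pd, hfh.fderiv_eq]

lemma differentiableAt_det {M : Fin 4 → Fin 4 → Pt → ℝ} {p : Pt}
    (hM : ∀ a b, DifferentiableAt ℝ (M a b) p) :
    DifferentiableAt ℝ (fun q => (valMatrix M q).det) p := by
  simp only [Matrix.det_apply, valMatrix, Matrix.of_apply]
  fun_prop

lemma differentiableAt_matrix_inv {M : Fin 4 → Fin 4 → Pt → ℝ} {p : Pt}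
    (hM : ∀ a b, DifferentiableAt ℝ (M a b) p) (hdet : (valMatrix M p).det ≠ 0) (a b : Fin 4) :
    DifferentiableAt ℝ (fun q => (valMatrix M q)⁻¹ a b) p := by
  have hadj : DifferentiableAt ℝ (fun q => (valMatrix M q).adjugate a b) p := by
    simp only [Matrix.adjugate_apply]
    refine differentiableAt_det
      (M := fun i j q => (valMatrix M q).updateRow b (Pi.single a 1) i j) fun i j => ?_
    by_cases h : i = b
    · subst h
      simp
    · simpa [Matrix.updateRow_ne h, valMatrix] using hM i j
  simp only [Matrix.inv_def, Ring.inverse_eq_inv', Matrix.smul_apply, smul_eq_mul]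
  exact ((differentiableAt_det hM).inv hdet).mul hadj

/-- The derivative of the inverse of a covariantly constant tensor. -/
lemma pdMatrix_inverse {U : Set Pt} (hU : IsOpen U)
    {Γ : Fin 4 → Fin 4 → Fin 4 → Pt → ℝ} {g ginv : Fin 4 → Fin 4 → Pt → ℝ}
    (hinv : ∀ q ∈ U, valMatrix g q * valMatrix ginv q = 1) {p : Pt} (hp : p ∈ U)
    (hg : ∀ a b, DifferentiableAt ℝ (g a b) p)
    (hginv : ∀ a b, DifferentiableAt ℝ (ginv a b) p) {c : Fin 4}
    (hcompat : covMatrix Γ g c p = 0) :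
    pdMatrix ginv c p = -(connMatrix Γ c p * valMatrix ginv p)
      - valMatrix ginv p * (connMatrix Γ c p).transpose := by
  have hd := pdMatrix_mul hg hginv c
  have h0 : pdMatrix (fun a b q => ∑ m, g a m q * ginv m b q) c p = 0 := by
    ext a b
    have he : (fun q => ∑ m, g a m q * ginv m b q)
        =ᶠ[nhds p] fun _ => (1 : Matrix (Fin 4) (Fin 4) ℝ) a b := by
      filter_upwards [hU.mem_nhds hp] with q hq
      rw [← hinv q hq]
      simp [valMatrix, Matrix.mul_apply]
    simp only [pdMatrix, Matrix.of_apply, pd_congr he c]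
    simp [pd]
  rw [covMatrix_eq, sub_sub, sub_eq_zero] at hcompat
  rw [h0, hcompat] at hd
  have hl := mul_eq_one_comm.mp (hinv p hp)
  have hr := hinv p hp
  generalize connMatrix Γ c p = A at *
  generalize valMatrix g p = G at *
  generalize valMatrix ginv p = I at *
  generalize pdMatrix ginv c p = D at *
  calc D = I * G * D := by rw [hl, one_mul]
    _ = I * ((A.transpose * G + G * A) * I + G * D) - I * A.transpose * (G * I)
        - (I * G) * A * I := by noncomm_ring
    _ = _ := by rw [← hd, hl, hr]; noncomm_ring

/-- The Leibniz rule for the square contracted with a covariantly constant inverse metric. -/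
lemma covMatrix_Ksq {Γ : Fin 4 → Fin 4 → Fin 4 → Pt → ℝ} {ginv Y : Fin 4 → Fin 4 → Pt → ℝ}
    {p : Pt} (hginv : ∀ a b, DifferentiableAt ℝ (ginv a b) p)
    (hY : ∀ a b, DifferentiableAt ℝ (Y a b) p) {c : Fin 4}
    (hd : pdMatrix ginv c p = -(connMatrix Γ c p * valMatrix ginv p)
      - valMatrix ginv p * (connMatrix Γ c p).transpose) :
    covMatrix Γ (Ksq ginv Y) c p = covMatrix Γ Y c p * valMatrix ginv p * valMatrix Y p
      + valMatrix Y p * valMatrix ginv p * covMatrix Γ Y c p := by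
  have hK : Ksq ginv Y
      = fun a b q => ∑ n, (∑ m, Y a m q * ginv m n q) * Y n b q := by
    funext a b q
    simp only [Ksq, Finset.sum_mul]
    exact Finset.sum_comm
  have hv : valMatrix (fun a n q => ∑ m, Y a m q * ginv m n q) p
      = valMatrix Y p * valMatrix ginv p := by
    ext a b
    simp [valMatrix, Matrix.mul_apply]
  have hvK : valMatrix (Ksq ginv Y) p = valMatrix Y p * valMatrix ginv p * valMatrix Y p := by
    ext a b
    simp [hK, valMatrix, Matrix.mul_apply]
  have hpd : pdMatrix (Ksq ginv Y) c p
      = pdMatrix (fun a n q => ∑ m, Y a m q * ginv m n q) c p * valMatrix Y p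
        + valMatrix (fun a n q => ∑ m, Y a m q * ginv m n q) p * pdMatrix Y c p := by
    rw [hK]
    exact pdMatrix_mul (M := fun a n q => ∑ m, Y a m q * ginv m n q)
      (fun a n => by fun_prop) hY c
  rw [covMatrix_eq, hpd, hvK, hv, pdMatrix_mul hY hginv, hd, covMatrix_eq]
  noncomm_ring

lemma cov2_antisymm {U : Set Pt} (hU : IsOpen U) (Γ : Fin 4 → Fin 4 → Fin 4 → Pt → ℝ)
    {Y : Fin 4 → Fin 4 → Pt → ℝ} (hY : ∀ a b, ∀ p ∈ U, Y a b p = -Y b a p)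
    {p : Pt} (hp : p ∈ U) (c a b : Fin 4) : cov2 Γ Y c a b p = -cov2 Γ Y c b a p := by
  have he : Y a b =ᶠ[nhds p] fun q => -Y b a q := by
    filter_upwards [hU.mem_nhds hp] with q hq using hY a b q hq
  have hpd : pd (Y a b) c p = -pd (Y b a) c p := by
    rw [pd_congr he]
    simp [pd]
  simp only [cov2, hpd, hY _ b p hp, hY a _ p hp, mul_neg, Finset.sum_neg_distrib]
  ring

/-- The matrix inverse of a symmetric matrix is symmetric. -/
lemma isSymm_of_mul_eq_one {G I : Matrix (Fin 4) (Fin 4) ℝ} (hG : G.IsSymm) (h : G * I = 1) :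
    I.IsSymm := by
  rw [← Matrix.inv_eq_right_inv h]
  exact hG.inv

theorem yano_square_is_killing_tensor
    (U : Set Pt) (hU : IsOpen U)
    (Γ : Fin 4 → Fin 4 → Fin 4 → Pt → ℝ)
    (hΓsmooth : ∀ m a b, ContDiffOn ℝ (⊤ : ℕ∞) (Γ m a b) U)
    (hΓsymm : ∀ m a b, ∀ p ∈ U, Γ m a b p = Γ m b a p)
    (g ginv : Fin 4 → Fin 4 → Pt → ℝ)
    (hgsmooth : ∀ a b, ContDiffOn ℝ (⊤ : ℕ∞) (g a b) U)
    (hgsymm : ∀ a b, ∀ p ∈ U, g a b p = g b a p)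
    (hginv : ∀ p ∈ U, ∀ a b, (∑ m, g a m p * ginv m b p) = if a = b then 1 else 0)
    (hcompat : ∀ p ∈ U, ∀ c a b, cov2 Γ g c a b p = 0)
    (Y : Fin 4 → Fin 4 → Pt → ℝ)
    (hYsmooth : ∀ a b, ContDiffOn ℝ (⊤ : ℕ∞) (Y a b) U)
    (hYanti : ∀ a b, ∀ p ∈ U, Y a b p = - Y b a p)
    (hYano : ∀ a b c, ∀ p ∈ U, cov2 Γ Y c b a p + cov2 Γ Y b c a p = 0) :
    ∀ p ∈ U,
      (∀ a b, Ksq ginv Y a b p = Ksq ginv Y b a p) ∧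
      (∀ a b c,
        cov2 Γ (Ksq ginv Y) a b c p + cov2 Γ (Ksq ginv Y) b c a p
          + cov2 Γ (Ksq ginv Y) c a b p = 0) := by
  intro p hp
  have hdiff {f : Pt → ℝ} (hf : ContDiffOn ℝ (⊤ : ℕ∞) f U) {q : Pt} (hq : q ∈ U) :
      DifferentiableAt ℝ f q :=
    (hf.contDiffAt (hU.mem_nhds hq)).differentiableAt (by simp)
  have hg a b := hdiff (hgsmooth a b) hp
  have hY a b := hdiff (hYsmooth a b) hp
  have hinv : ∀ q ∈ U, valMatrix g q * valMatrix ginv q = 1 := by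
    intro q hq
    ext a b
    simpa [valMatrix, Matrix.mul_apply, Matrix.one_apply] using hginv q hq a b
  have hgi : ∀ a b, DifferentiableAt ℝ (ginv a b) p := by
    intro a b
    refine (differentiableAt_matrix_inv hg (Matrix.det_ne_zero_of_right_inverse (hinv p hp)) a b
      ).congr_of_eventuallyEq ?_
    filter_upwards [hU.mem_nhds hp] with q hq
    rw [Matrix.inv_eq_right_inv (hinv q hq)]
    simp [valMatrix]
  have hIt : (valMatrix ginv p).transpose = valMatrix ginv p :=
    isSymm_of_mul_eq_one (by ext a b; exact hgsymm b a p hp) (hinv p hp)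
  have hYt : (valMatrix Y p).transpose = -valMatrix Y p := by
    ext a b
    exact hYanti b a p hp
  have hDt c : (covMatrix Γ Y c p).transpose = -covMatrix Γ Y c p := by
    ext a b
    exact cov2_antisymm hU Γ hYanti hp c b a
  refine ⟨fun a b => ?_, fun a b c => ?_⟩
  · have hK a b : Ksq ginv Y a b p
        = (valMatrix Y p * (valMatrix ginv p * valMatrix Y p)) a b := by
      simp [Ksq, valMatrix, Matrix.mul_apply, Finset.mul_sum, mul_assoc]
    have hKt : (valMatrix Y p * (valMatrix ginv p * valMatrix Y p)).transpose
        = valMatrix Y p * (valMatrix ginv p * valMatrix Y p) := by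
      simp [Matrix.transpose_mul, hIt, hYt, mul_assoc]
    rw [hK, hK]
    exact congrFun₂ hKt b a
  · let S (c : Fin 4) := covMatrix Γ Y c p * (valMatrix ginv p * valMatrix Y p)
    have hcov c a b : cov2 Γ (Ksq ginv Y) c a b p = S c a b + S c b a := by
      have hd := pdMatrix_inverse hU hinv hp hg hgi (c := c) (by ext a b; exact hcompat p hp c a b)
      have h := congrFun₂ (covMatrix_Ksq hgi hY hd) a b
      have ht : (S c).transpose = valMatrix Y p * valMatrix ginv p * covMatrix Γ Y c p := by
        simp [S, Matrix.transpose_mul, hIt, hYt, hDt]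
      rwa [← ht, mul_assoc] at h
    have hS a b c : S a b c = -S b a c := by
      simp only [S, Matrix.mul_apply (M := covMatrix Γ Y _ p), ← Finset.sum_neg_distrib]
      refine Finset.sum_congr rfl fun m _ => ?_
      have h : covMatrix Γ Y a p b m = -covMatrix Γ Y b p a m :=
        eq_neg_of_add_eq_zero_left (hYano m b a p hp)
      rw [h, neg_mul]
    rw [hcov, hcov, hcov, hS b a c, hS c a b, hS c b a]
    ring
end
end
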